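/- Fix a finite index type n (the states), reals 0 ≤ γ < 1, 0 ≤ ε ≤ 1, and R_max ≥ 0. Let T and U be n×n row-stochastic matrices (all entries nonnegative, each row summing to 1), and let R_π and R_u be vectors in ℝ^n with 0 ≤ R_π(s) ≤ R_max and 0 ≤ R_u(s) ≤ R_max for all s. Define T_ε = (1−ε)·T + ε·U and R_ε = (1−ε)·R_π + ε·R_u, and define the value vectors V = ∑_{t=1}^∞ γ^{t−1} T^{t−1} R_π and V_ε = ∑_{t=1}^∞ γ^{t−1} T_ε^{t−1} R_ε (both series converge). Then for every state s, V(s) − V_ε(s) ≤ ε · R_max / ((1−γ)(1 − γ(1−ε))). -/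

import Mathlib

open Matrix

theorem mulVec_mem_Icc_of_mem_rowStochastic {n : Type*} [Fintype n] [DecidableEq n]
    {M : Matrix n n ℝ} (hM : M ∈ rowStochastic ℝ n) {v : n → ℝ} {c : ℝ}
    (hv : ∀ i, v i ∈ Set.Icc 0 c) (i : n) : (M *ᵥ v) i ∈ Set.Icc 0 c := by
  rw [mem_rowStochastic_iff_sum] at hM
  refine ⟨Finset.sum_nonneg fun j _ => mul_nonneg (hM.1 i j) (hv j).1, ?_⟩
  calc ∑ j, M i j * v j ≤ ∑ j, M i j * c :=
        Finset.sum_le_sum fun j _ => mul_le_mul_of_nonneg_left (hv j).2 (hM.1 i j)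
    _ = c := by rw [← Finset.sum_mul, hM.2 i, one_mul]

theorem summable_discounted_of_mem_rowStochastic {n : Type*} [Fintype n] [DecidableEq n]
    {M : Matrix n n ℝ} (hM : M ∈ rowStochastic ℝ n) {v : n → ℝ} {c γ : ℝ}
    (hγ0 : 0 ≤ γ) (hγ1 : γ < 1) (hv : ∀ i, v i ∈ Set.Icc 0 c) :
    Summable fun t : ℕ => γ ^ t • (M ^ t) *ᵥ v := by
  rw [Pi.summable]
  intro i
  have h (t : ℕ) := mulVec_mem_Icc_of_mem_rowStochastic (pow_mem hM t) hv i
  refine Summable.of_nonneg_of_le (fun t => ?_) (fun t => ?_)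
    ((summable_geometric_of_lt_one hγ0 hγ1).mul_right c)
  · exact mul_nonneg (pow_nonneg hγ0 t) (h t).1
  · exact mul_le_mul_of_nonneg_left (h t).2 (pow_nonneg hγ0 t)

/-- If `a • T ≤ S` and `a • v ≤ w` entrywise, then `a ^ (t + 1) • T ^ t v ≤ S ^ t w`. -/
theorem pow_mul_pow_mulVec_le {n : Type*} [Fintype n] [DecidableEq n]
    {T S : Matrix n n ℝ} {v w : n → ℝ} {a : ℝ} (hS : ∀ i j, 0 ≤ S i j)
    (hT : T ∈ rowStochastic ℝ n) (ha : 0 ≤ a) (hv : ∀ i, 0 ≤ v i)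
    (hTS : ∀ i j, a * T i j ≤ S i j) (hvw : ∀ i, a * v i ≤ w i) (t : ℕ) (i : n) :
    a ^ (t + 1) * ((T ^ t) *ᵥ v) i ≤ ((S ^ t) *ᵥ w) i := by
  induction t generalizing i with
  | zero => simpa using hvw i
  | succ t ih =>
    rw [pow_succ' T, pow_succ' S, ← mulVec_mulVec, ← mulVec_mulVec]
    change _ * ∑ j, T i j * ((T ^ t) *ᵥ v) j ≤ ∑ j, S i j * ((S ^ t) *ᵥ w) j
    rw [Finset.mul_sum]
    refine Finset.sum_le_sum fun j _ => ?_
    have hx : 0 ≤ ((T ^ t) *ᵥ v) j :=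
      Finset.sum_nonneg fun k _ =>
        mul_nonneg (nonneg_of_mem_rowStochastic (pow_mem hT t)) (hv k)
    calc a ^ (t + 1 + 1) * (T i j * ((T ^ t) *ᵥ v) j)
        = (a * T i j) * (a ^ (t + 1) * ((T ^ t) *ᵥ v) j) := by ring
      _ ≤ S i j * ((S ^ t) *ᵥ w) j :=
        mul_le_mul (hTS i j) (ih j) (mul_nonneg (pow_nonneg ha _) hx) (hS i j)

/-- Core content of Lemma 2 of the paper: with `T = T^π` and `U = T^u` row-stochastic,
rewards `R_π, R_u` in `[0, R_max]`, `T_ε = (1−ε)T + εU`, `R_ε = (1−ε)R_π + εR_u`,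
the value vectors `V = ∑_{t≥1} γ^{t−1} T^{t−1} R_π` and
`V_ε = ∑_{t≥1} γ^{t−1} T_ε^{t−1} R_ε` converge, and for every state `s`,
`V(s) − V_ε(s) ≤ ε R_max / ((1−γ)(1 − γ(1−ε)))`. -/
theorem epsilon_greedy_value_bound {n : Type*} [Fintype n] [DecidableEq n]
    (γ ε Rmax : ℝ) (hγ0 : 0 ≤ γ) (hγ1 : γ < 1) (hε0 : 0 ≤ ε) (hε1 : ε ≤ 1)
    (hRmax : 0 ≤ Rmax)
    (T U : Matrix n n ℝ)
    (hT0 : ∀ i j, 0 ≤ T i j) (hT1 : ∀ i, ∑ j, T i j = 1)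
    (hU0 : ∀ i j, 0 ≤ U i j) (hU1 : ∀ i, ∑ j, U i j = 1)
    (Rπ Ru : n → ℝ)
    (hRπ : ∀ s, 0 ≤ Rπ s ∧ Rπ s ≤ Rmax) (hRu : ∀ s, 0 ≤ Ru s ∧ Ru s ≤ Rmax) :
    Summable (fun t : ℕ => γ ^ t • (T ^ t).mulVec Rπ) ∧
    Summable (fun t : ℕ =>
      γ ^ t • (((1 - ε) • T + ε • U) ^ t).mulVec ((1 - ε) • Rπ + ε • Ru)) ∧
    ∀ s : n,
      (∑' t : ℕ, γ ^ t • (T ^ t).mulVec Rπ) s -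
        (∑' t : ℕ,
          γ ^ t • (((1 - ε) • T + ε • U) ^ t).mulVec ((1 - ε) • Rπ + ε • Ru)) s ≤
      ε * Rmax / ((1 - γ) * (1 - γ * (1 - ε))) := by
  have ha0 : 0 ≤ 1 - ε := by linarith
  have hT : T ∈ rowStochastic ℝ n := mem_rowStochastic_iff_sum.2 ⟨hT0, hT1⟩
  have hU : U ∈ rowStochastic ℝ n := mem_rowStochastic_iff_sum.2 ⟨hU0, hU1⟩
  have hS : (1 - ε) • T + ε • U ∈ rowStochastic ℝ n :=
    convex_rowStochastic hT hU ha0 hε0 (by ring)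
  have hR (i : n) : ((1 - ε) • Rπ + ε • Ru) i ∈ Set.Icc 0 Rmax :=
    convex_Icc 0 Rmax (hRπ i) (hRu i) ha0 hε0 (by ring)
  have hV := summable_discounted_of_mem_rowStochastic hT hγ0 hγ1 hRπ
  have hVε := summable_discounted_of_mem_rowStochastic hS hγ0 hγ1 hR
  refine ⟨hV, hVε, fun s => ?_⟩
  have hb0 : 0 ≤ γ * (1 - ε) := mul_nonneg hγ0 ha0
  have hb1 : γ * (1 - ε) < 1 := by nlinarith
  have hgeom : HasSum (fun t : ℕ => (γ ^ t - (1 - ε) * (γ * (1 - ε)) ^ t) * Rmax)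
      (((1 - γ)⁻¹ - (1 - ε) * (1 - γ * (1 - ε))⁻¹) * Rmax) :=
    ((hasSum_geometric_of_lt_one hγ0 hγ1).sub
      ((hasSum_geometric_of_lt_one hb0 hb1).mul_left _)).mul_right _
  have hval : ((1 - γ)⁻¹ - (1 - ε) * (1 - γ * (1 - ε))⁻¹) * Rmax =
      ε * Rmax / ((1 - γ) * (1 - γ * (1 - ε))) := by
    have h1 : 1 - γ ≠ 0 := by linarith
    have h2 : 1 - γ * (1 - ε) ≠ 0 := by linarith
    field_simp
    ring
  rw [← hval]
  refine hasSum_le (fun t => ?_)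
    ((Pi.hasSum.1 hV.hasSum s).sub (Pi.hasSum.1 hVε.hasSum s)) hgeom
  have hx := mulVec_mem_Icc_of_mem_rowStochastic (pow_mem hT t) hRπ s
  have hy := pow_mul_pow_mulVec_le (S := (1 - ε) • T + ε • U) (w := (1 - ε) • Rπ + ε • Ru)
    (fun i j => nonneg_of_mem_rowStochastic hS) hT ha0 (fun i => (hRπ i).1)
    (fun i j => le_add_of_nonneg_right (mul_nonneg hε0 (hU0 i j)))
    (fun i => le_add_of_nonneg_right (mul_nonneg hε0 (hRu i).1)) t s
  have hp : (1 - ε) ^ (t + 1) ≤ 1 := pow_le_one₀ ha0 (by linarith)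
  simp only [Pi.smul_apply, smul_eq_mul]
  calc γ ^ t * ((T ^ t) *ᵥ Rπ) s -
        γ ^ t * ((((1 - ε) • T + ε • U) ^ t) *ᵥ ((1 - ε) • Rπ + ε • Ru)) s
      ≤ γ ^ t * ((1 - (1 - ε) ^ (t + 1)) * ((T ^ t) *ᵥ Rπ) s) := by
        rw [← mul_sub]
        exact mul_le_mul_of_nonneg_left (by linarith) (pow_nonneg hγ0 t)
    _ ≤ γ ^ t * ((1 - (1 - ε) ^ (t + 1)) * Rmax) :=
        mul_le_mul_of_nonneg_left
          (mul_le_mul_of_nonneg_left hx.2 (sub_nonneg.2 hp)) (pow_nonneg hγ0 t)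
    _ = (γ ^ t - (1 - ε) * (γ * (1 - ε)) ^ t) * Rmax := by rw [mul_pow]; ring
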